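/- Let {p_i, ρ_i} be an ensemble of letter states on a finite alphabet A with average state η_i, and let I be an instrument with finite outcome set Ω, operations O(ω) and POV measure E. Then I_c{p_i, ρ_i; E} ≤ χ{p_i, ρ_i} + χ{p_f, ρ_f} − χ{p_{if}, ρ_f^•}, where {p_f, ρ_f} is the ensemble of a posteriori states of the average (ρ_f(ω) = O(ω)[η_i]/p_f(ω)) and {p_{if}, ρ_f^•} is the joint ensemble with probabilities p_{if}(α,ω) and states ρ_f^α(ω) = O(ω)[ρ_i(α)]/p_{f|i}(ω|α); both of the latter ensembles have average state η_f = Σ_ω O(ω)[η_i]. -/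

import Mathlib

open Matrix Finset
open scoped BigOperators ComplexOrder

noncomputable section

/-- Matrix logarithm of a Hermitian matrix via the spectral decomposition
(with the convention `Real.log 0 = 0` on the kernel); `0` for non-Hermitian matrices. -/
def matLog {d : ℕ} (A : Matrix (Fin d) (Fin d) ℂ) : Matrix (Fin d) (Fin d) ℂ :=
  if hA : A.IsHermitian then
    (hA.eigenvectorUnitary : Matrix (Fin d) (Fin d) ℂ) *
      Matrix.diagonal (fun i => (Real.log (hA.eigenvalues i) : ℂ)) *
      star (hA.eigenvectorUnitary : Matrix (Fin d) (Fin d) ℂ)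
  else 0

/-- The von Neumann entropy `S_q(ρ) = −Tr(ρ log ρ)`. -/
def vnEntropy {d : ℕ} (ρ : Matrix (Fin d) (Fin d) ℂ) : ℝ :=
  -(Matrix.trace (ρ * matLog ρ)).re

/-- The quantum relative entropy `S_q(ρ‖φ) = Tr(ρ (log ρ − log φ))`. -/
def qRelEntropy {d : ℕ} (ρ φ : Matrix (Fin d) (Fin d) ℂ) : ℝ :=
  (Matrix.trace (ρ * (matLog ρ - matLog φ))).re

/-- The classical relative entropy `S_c(p‖q) = Σ_{ω : p ω > 0} p ω log (p ω / q ω)`. -/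
def cRelEntropy {Ω : Type*} [Fintype Ω] (p q : Ω → ℝ) : ℝ :=
  ∑ ω ∈ Finset.univ.filter (fun ω => 0 < p ω), p ω * Real.log (p ω / q ω)

/-- The probability of outcome `ω` for POV measure `E` in the state `ρ`. -/
def povProb {d : ℕ} {Ω : Type*} (E : Ω → Matrix (Fin d) (Fin d) ℂ)
    (ρ : Matrix (Fin d) (Fin d) ℂ) (ω : Ω) : ℝ :=
  (Matrix.trace (E ω * ρ)).re

/-- The χ-quantity of the ensemble `{p, σ}` (relative entropies w.r.t. the average state). -/
def chiQuantity {d : ℕ} {X : Type*} [Fintype X] (p : X → ℝ)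
    (σ : X → Matrix (Fin d) (Fin d) ℂ) : ℝ :=
  ∑ x ∈ Finset.univ.filter (fun x => 0 < p x),
    p x * qRelEntropy (σ x) (∑ y, p y • σ y)

/-- The operation `O(ω)[ρ] = Σ_k V_k^ω ρ (V_k^ω)†` of the instrument with Kraus family `V`. -/
def instrOp {d : ℕ} {Ω K : Type*} [Fintype K] (V : Ω → K → Matrix (Fin d) (Fin d) ℂ)
    (ω : Ω) (ρ : Matrix (Fin d) (Fin d) ℂ) : Matrix (Fin d) (Fin d) ℂ :=
  ∑ k, V ω k * ρ * (V ω k)ᴴ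

/-- The POV measure `E(ω) = Σ_k (V_k^ω)† V_k^ω` associated with the instrument `V`. -/
def instrPOV {d : ℕ} {Ω K : Type*} [Fintype K] (V : Ω → K → Matrix (Fin d) (Fin d) ℂ)
    (ω : Ω) : Matrix (Fin d) (Fin d) ℂ :=
  ∑ k, (V ω k)ᴴ * V ω k

/-- The outcome probability `p_ρ(ω) = Tr(E(ω) ρ)` of the instrument `V`. -/
def outcomeProb {d : ℕ} {Ω K : Type*} [Fintype K] (V : Ω → K → Matrix (Fin d) (Fin d) ℂ)
    (ρ : Matrix (Fin d) (Fin d) ℂ) (ω : Ω) : ℝ :=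
  (Matrix.trace (instrPOV V ω * ρ)).re

/-- The a posteriori state `π_ρ(ω) = O(ω)[ρ] / p_ρ(ω)` of the instrument `V`. -/
def postState {d : ℕ} {Ω K : Type*} [Fintype K] (V : Ω → K → Matrix (Fin d) (Fin d) ℂ)
    (ρ : Matrix (Fin d) (Fin d) ℂ) (ω : Ω) : Matrix (Fin d) (Fin d) ℂ :=
  (outcomeProb V ρ ω)⁻¹ • instrOp V ω ρ

/-- The classical input/output mutual information `I_c{p, ρ; E}` for the ensemble `{p, ρ}`
measured with the POV measure `E`. -/
def mutualInfo {d : ℕ} {A Ω : Type*} [Fintype A] [Fintype Ω]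
    (p : A → ℝ) (ρ : A → Matrix (Fin d) (Fin d) ℂ)
    (E : Ω → Matrix (Fin d) (Fin d) ℂ) : ℝ :=
  ∑ x ∈ Finset.univ.filter (fun x : A × Ω => 0 < p x.1 * povProb E (ρ x.1) x.2),
    (p x.1 * povProb E (ρ x.1) x.2) *
      Real.log ((p x.1 * povProb E (ρ x.1) x.2) /
        (p x.1 * povProb E (∑ α, p α • ρ α) x.2))

/-- The quantum information gain `I_q(ρ; I)` of the instrument `V` on the state `ρ`. -/
def infoGain {d : ℕ} {Ω K : Type*} [Fintype Ω] [Fintype K]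
    (V : Ω → K → Matrix (Fin d) (Fin d) ℂ) (ρ : Matrix (Fin d) (Fin d) ℂ) : ℝ :=
  vnEntropy ρ - ∑ ω ∈ Finset.univ.filter (fun ω => 0 < outcomeProb V ρ ω),
    outcomeProb V ρ ω * vnEntropy (postState V ρ ω)

/-- A pure state: a rank-one orthogonal projection. -/
def IsPureState {d : ℕ} (ρ : Matrix (Fin d) (Fin d) ℂ) : Prop :=
  ρ.IsHermitian ∧ ρ * ρ = ρ ∧ ρ.rank = 1

end

section LogIntegral

/-- Integrated form of `log x - log y = ∫ (1 / (y + t) - 1 / (x + t)) dt`, for signed weights. -/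
theorem sum_mul_log_sub_log_nonneg {ι : Type*} [Fintype ι] (s a b : ι → ℝ)
    (ha : ∀ i, 0 ≤ a i) (hb : ∀ i, 0 ≤ b i) (hab : ∀ i, s i ≠ 0 → a i ≠ 0 → b i ≠ 0)
    (hsum : ∑ i, s i * a i = 0)
    (hres : ∀ t : ℝ, 0 < t → 0 ≤ ∑ i, s i * (a i ^ 2 / (b i + t * a i))) :
    0 ≤ ∑ i, s i * (a i * (Real.log (a i) - Real.log (b i))) := by
  set H : ℝ → ℝ := fun t => ∑ i, s i * (a i * Real.log (b i + t * a i)) with hH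
  have hdisj : ∀ i, s i = 0 ∨ a i = 0 ∨ (0 < a i ∧ 0 < b i) := by
    intro i
    by_cases h1 : s i = 0
    · exact Or.inl h1
    by_cases h2 : a i = 0
    · exact Or.inr (Or.inl h2)
    exact Or.inr (Or.inr ⟨(ha i).lt_of_ne' h2, (hb i).lt_of_ne' (hab i h1 h2)⟩)
  have hderiv : ∀ t : ℝ, 0 ≤ t →
      HasDerivAt H (∑ i, s i * (a i ^ 2 / (b i + t * a i))) t := by
    intro t ht
    refine HasDerivAt.fun_sum fun i _ => ?_
    rcases hdisj i with h | h | ⟨h1, h2⟩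
    · simpa [h] using hasDerivAt_const t (0 : ℝ)
    · simpa [h] using hasDerivAt_const t (0 : ℝ)
    · have hpos : b i + t * a i ≠ 0 := by positivity
      have h3 := ((((hasDerivAt_id t).mul_const (a i)).const_add (b i)).log hpos).const_mul (a i)
      have h4 := h3.const_mul (s i)
      refine h4.congr_deriv ?_
      simp only [id_eq, one_mul]
      ring
  have hmono : MonotoneOn H (Set.Ici 0) := by
    refine monotoneOn_of_deriv_nonneg (convex_Ici 0)
      (fun t ht => (hderiv t ht).continuousAt.continuousWithinAt)
      (fun t ht => ?_) (fun t ht => ?_)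
    · rw [interior_Ici] at ht
      exact (hderiv t (le_of_lt ht)).differentiableAt.differentiableWithinAt
    · rw [interior_Ici] at ht
      rw [(hderiv t (le_of_lt ht)).deriv]
      exact hres t ht
  have hlim : Filter.Tendsto (fun t : ℝ => ∑ i, s i * (a i * Real.log (b i / t + a i)))
      Filter.atTop (nhds (∑ i, s i * (a i * Real.log (a i)))) := by
    refine tendsto_finsetSum _ fun i _ => ?_
    rcases hdisj i with h | h | ⟨h1, h2⟩
    · simp [h]
    · simp [h]
    · refine Filter.Tendsto.const_mul _ (Filter.Tendsto.const_mul _ ?_)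
      refine Filter.Tendsto.log ?_ h1.ne'
      simpa using (tendsto_const_nhds.div_atTop Filter.tendsto_id).add_const (a i)
  have hle : H 0 ≤ ∑ i, s i * (a i * Real.log (a i)) := by
    refine ge_of_tendsto hlim ?_
    filter_upwards [Filter.eventually_gt_atTop (0 : ℝ)] with t ht
    refine (hmono Set.self_mem_Ici ht.le ht.le).trans (le_of_eq ?_)
    have h : ∀ i, s i * (a i * Real.log (b i + t * a i)) =
        s i * (a i * Real.log (b i / t + a i)) + s i * a i * Real.log t := by
      intro i
      rcases hdisj i with h | h | ⟨h1, h2⟩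
      · simp [h]
      · simp [h]
      · have : b i + t * a i = (b i / t + a i) * t := by field_simp
        rw [this, Real.log_mul (by positivity) ht.ne']
        ring
    rw [hH]
    simp only [h]
    rw [Finset.sum_add_distrib, ← Finset.sum_mul, hsum, zero_mul, add_zero]
  have : ∑ i, s i * (a i * (Real.log (a i) - Real.log (b i))) =
      ∑ i, s i * (a i * Real.log (a i)) - H 0 := by
    rw [hH, ← Finset.sum_sub_distrib]
    refine Finset.sum_congr rfl fun i _ => ?_
    simp only [zero_mul, add_zero]
    ring
  linarith

end LogIntegral

section UnitaryDiagonal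

variable {n : Type*} [Fintype n] [DecidableEq n]

/-- The Hermitian matrix with eigenvalues `a` and eigenvectors the columns of `U`. -/
def unitaryDiag (U : Matrix.unitaryGroup n ℂ) (a : n → ℝ) : Matrix n n ℂ :=
  (U : Matrix n n ℂ) * Matrix.diagonal (fun i => (a i : ℂ)) * (U : Matrix n n ℂ)ᴴ

/-- The squared overlaps of the columns of `U` with those of `W`. -/
def sqOverlap (U W : Matrix.unitaryGroup n ℂ) (i j : n) : ℝ :=
  Complex.normSq (((W : Matrix n n ℂ)ᴴ * (U : Matrix n n ℂ)) j i)

theorem conjTranspose_mul_self_unitaryGroup (U : Matrix.unitaryGroup n ℂ) :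
    (U : Matrix n n ℂ)ᴴ * (U : Matrix n n ℂ) = 1 :=
  Matrix.UnitaryGroup.star_mul_self U

theorem self_mul_conjTranspose_unitaryGroup (U : Matrix.unitaryGroup n ℂ) :
    (U : Matrix n n ℂ) * (U : Matrix n n ℂ)ᴴ = 1 :=
  Matrix.mem_unitaryGroup_iff.mp U.2

theorem sqOverlap_nonneg (U W : Matrix.unitaryGroup n ℂ) (i j : n) : 0 ≤ sqOverlap U W i j :=
  Complex.normSq_nonneg _

theorem unitaryDiag_mul (U : Matrix.unitaryGroup n ℂ) (a b : n → ℝ) :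
    unitaryDiag U a * unitaryDiag U b = unitaryDiag U (fun i => a i * b i) := by
  have h := conjTranspose_mul_self_unitaryGroup U
  calc unitaryDiag U a * unitaryDiag U b
      = (U : Matrix n n ℂ) * Matrix.diagonal (fun i => (a i : ℂ)) *
          ((U : Matrix n n ℂ)ᴴ * (U : Matrix n n ℂ)) * Matrix.diagonal (fun i => (b i : ℂ)) *
          (U : Matrix n n ℂ)ᴴ := by simp only [unitaryDiag, Matrix.mul_assoc]
    _ = _ := by
      rw [h, Matrix.mul_one, Matrix.mul_assoc (U : Matrix n n ℂ), Matrix.diagonal_mul_diagonal]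
      simp [unitaryDiag]

theorem unitaryDiag_smul (U : Matrix.unitaryGroup n ℂ) (c : ℝ) (a : n → ℝ) :
    c • unitaryDiag U a = unitaryDiag U (fun i => c * a i) := by
  have : Matrix.diagonal (fun i => ((c * a i : ℝ) : ℂ)) =
      c • Matrix.diagonal (fun i => (a i : ℂ)) := by
    rw [← Matrix.diagonal_smul]
    congr 1
    ext i
    simp
  rw [unitaryDiag, unitaryDiag, this, Matrix.mul_smul, Matrix.smul_mul]

theorem unitaryDiag_one (U : Matrix.unitaryGroup n ℂ) : unitaryDiag U (fun _ => 1) = 1 := by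
  simp [unitaryDiag, self_mul_conjTranspose_unitaryGroup U]

theorem trace_unitaryDiag (U : Matrix.unitaryGroup n ℂ) (a : n → ℝ) :
    (unitaryDiag U a).trace = ∑ i, (a i : ℂ) := by
  rw [unitaryDiag, Matrix.trace_mul_comm, ← Matrix.mul_assoc,
    conjTranspose_mul_self_unitaryGroup, Matrix.one_mul, Matrix.trace_diagonal]

theorem trace_unitaryDiag_mul (U W : Matrix.unitaryGroup n ℂ) (a b : n → ℝ) :
    (unitaryDiag U a * unitaryDiag W b).trace.re =
      ∑ i, ∑ j, sqOverlap U W i j * (a i * b j) := by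
  set M := (W : Matrix n n ℂ)ᴴ * (U : Matrix n n ℂ) with hM
  have h : (unitaryDiag U a * unitaryDiag W b).trace =
      (Matrix.diagonal (fun i => (a i : ℂ)) * (Mᴴ * Matrix.diagonal (fun i => (b i : ℂ)) * M)).trace
      := by
    rw [hM, Matrix.conjTranspose_mul, Matrix.conjTranspose_conjTranspose]
    simp only [unitaryDiag, Matrix.mul_assoc]
    rw [Matrix.trace_mul_comm]
    simp only [Matrix.mul_assoc]
  rw [h, Matrix.trace, Complex.re_sum]
  refine Finset.sum_congr rfl fun i _ => ?_
  rw [Matrix.diag_apply, Matrix.diagonal_mul, Matrix.mul_apply, Finset.mul_sum, Complex.re_sum]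
  refine Finset.sum_congr rfl fun j _ => ?_
  rw [Matrix.mul_diagonal, Matrix.conjTranspose_apply, sqOverlap, ← hM, Complex.normSq_apply]
  simp
  ring

theorem sum_sqOverlap_mul (U W : Matrix.unitaryGroup n ℂ) (a : n → ℝ) :
    ∑ i, ∑ j, sqOverlap U W i j * a i = ∑ i, a i := by
  have h := trace_unitaryDiag_mul U W a (fun _ => 1)
  rw [unitaryDiag_one, Matrix.mul_one, trace_unitaryDiag, Complex.re_sum] at h
  simpa using h.symm

theorem ne_zero_of_posSemidef_smul_sub (U W : Matrix.unitaryGroup n ℂ) (a b : n → ℝ)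
    (ha : ∀ i, 0 ≤ a i) (c : ℝ)
    (h : (c • unitaryDiag W b - unitaryDiag U a).PosSemidef) (i j : n)
    (hij : sqOverlap U W i j ≠ 0) (hai : a i ≠ 0) : b j ≠ 0 := by
  intro hbj
  set P : n → ℝ := Pi.single j 1 with hP
  have hPP : unitaryDiag W P * unitaryDiag W P = unitaryDiag W P := by
    rw [unitaryDiag_mul]
    congr 1
    ext k
    by_cases hk : k = j <;> simp [hP, hk]
  have hPH : (unitaryDiag W P)ᴴ = unitaryDiag W P := by
    have hd : Matrix.diagonal (fun i => (P i : ℂ)) =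
        (Matrix.diagonal (fun i => (P i : ℂ)))ᴴ := by
      rw [Matrix.diagonal_conjTranspose]
      congr 1
      ext k
      simp
    rw [unitaryDiag, Matrix.conjTranspose_mul, Matrix.conjTranspose_mul, ← hd,
      Matrix.conjTranspose_conjTranspose, Matrix.mul_assoc]
  have h1 := (Complex.le_def.mp
    (h.mul_mul_conjTranspose_same (unitaryDiag W P)).trace_nonneg).1
  have h0 : unitaryDiag W b * unitaryDiag W P = 0 := by
    rw [unitaryDiag_mul]
    have : (fun i => b i * P i) = fun _ => (0 : ℝ) := by
      ext k
      by_cases hk : k = j <;> simp [hP, hk, hbj]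
    rw [this]
    simp [unitaryDiag]
  rw [hPH, Matrix.mul_assoc, Matrix.trace_mul_comm, Matrix.mul_assoc, hPP, Matrix.sub_mul,
    Matrix.smul_mul, h0, smul_zero, zero_sub, Matrix.trace_neg, Complex.neg_re,
    trace_unitaryDiag_mul] at h1
  have h2 : sqOverlap U W i j * (a i * P j) ≤
      ∑ i, ∑ j, sqOverlap U W i j * (a i * P j) := by
    have hnn : ∀ i j, 0 ≤ sqOverlap U W i j * (a i * P j) := fun k l =>
      mul_nonneg (sqOverlap_nonneg U W k l) (mul_nonneg (ha k) (by
        by_cases hl : l = j <;> simp [hP, hl]))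
    refine (Finset.single_le_sum (fun l _ => hnn i l) (Finset.mem_univ j)).trans ?_
    exact Finset.single_le_sum (f := fun i => ∑ j, sqOverlap U W i j * (a i * P j))
      (fun k _ => Finset.sum_nonneg fun l _ => hnn k l) (Finset.mem_univ i)
  have h3 : 0 < sqOverlap U W i j * (a i * P j) := by
    have := (sqOverlap_nonneg U W i j).lt_of_ne' hij
    have := (ha i).lt_of_ne' hai
    simp only [hP, Pi.single_eq_same, mul_one]
    positivity
  simp only [Complex.zero_re] at h1
  linarith

end UnitaryDiagonal

section Variational

variable {n : Type*} [Fintype n]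

/-- The quadratic functional of `X` whose maximum is `⟨ρ, (L_σ + t R_ρ)⁻¹ ρ⟩`, with `L_σ` and
`R_ρ` the left and right multiplications and the Hilbert–Schmidt inner product. -/
def resolventForm (t : ℝ) (ρ σ X : Matrix n n ℂ) : ℝ :=
  2 * (Xᴴ * ρ).trace.re - (Xᴴ * σ * X).trace.re - t * (X * ρ * Xᴴ).trace.re

variable [DecidableEq n]

theorem resolventForm_unitaryDiag (t : ℝ) (U W : Matrix.unitaryGroup n ℂ) (a b : n → ℝ)
    (Z : Matrix n n ℂ) :
    resolventForm t (unitaryDiag U a) (unitaryDiag W b)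
        ((W : Matrix n n ℂ) * Z * (U : Matrix n n ℂ)ᴴ) =
      ∑ i, ∑ j, (2 * a i * (star (Z j i) *
        ((W : Matrix n n ℂ)ᴴ * (U : Matrix n n ℂ)) j i).re -
          (b j + t * a i) * Complex.normSq (Z j i)) := by
  have hU := conjTranspose_mul_self_unitaryGroup U
  have hW := conjTranspose_mul_self_unitaryGroup W
  have hU' : ∀ B : Matrix n n ℂ, (U : Matrix n n ℂ)ᴴ * ((U : Matrix n n ℂ) * B) = B := fun B => by
    rw [← Matrix.mul_assoc, hU, Matrix.one_mul]
  have hW' : ∀ B : Matrix n n ℂ, (W : Matrix n n ℂ)ᴴ * ((W : Matrix n n ℂ) * B) = B := fun B => by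
    rw [← Matrix.mul_assoc, hW, Matrix.one_mul]
  set M := (W : Matrix n n ℂ)ᴴ * (U : Matrix n n ℂ) with hM
  have e1 : (((W : Matrix n n ℂ) * Z * (U : Matrix n n ℂ)ᴴ)ᴴ * unitaryDiag U a).trace =
      (Zᴴ * M * Matrix.diagonal (fun i => (a i : ℂ))).trace := by
    simp only [unitaryDiag, Matrix.conjTranspose_mul, Matrix.conjTranspose_conjTranspose,
      Matrix.mul_assoc, hM]
    rw [Matrix.trace_mul_comm]
    simp only [Matrix.mul_assoc, hU, Matrix.mul_one]
  have e2 : (((W : Matrix n n ℂ) * Z * (U : Matrix n n ℂ)ᴴ)ᴴ * unitaryDiag W b *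
      ((W : Matrix n n ℂ) * Z * (U : Matrix n n ℂ)ᴴ)).trace =
      (Zᴴ * Matrix.diagonal (fun i => (b i : ℂ)) * Z).trace := by
    simp only [unitaryDiag, Matrix.conjTranspose_mul, Matrix.conjTranspose_conjTranspose,
      Matrix.mul_assoc, hW']
    rw [Matrix.trace_mul_comm]
    simp only [Matrix.mul_assoc, hU, Matrix.mul_one]
  have e3 : (((W : Matrix n n ℂ) * Z * (U : Matrix n n ℂ)ᴴ) * unitaryDiag U a *
      ((W : Matrix n n ℂ) * Z * (U : Matrix n n ℂ)ᴴ)ᴴ).trace =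
      (Z * Matrix.diagonal (fun i => (a i : ℂ)) * Zᴴ).trace := by
    simp only [unitaryDiag, Matrix.conjTranspose_mul, Matrix.conjTranspose_conjTranspose,
      Matrix.mul_assoc, hU']
    rw [Matrix.trace_mul_comm]
    simp only [Matrix.mul_assoc, hW, Matrix.mul_one]
  rw [resolventForm, e1, e2, e3]
  have f1 : (Zᴴ * M * Matrix.diagonal (fun i => (a i : ℂ))).trace.re =
      ∑ i, ∑ j, a i * (star (Z j i) * M j i).re := by
    rw [Matrix.trace, Complex.re_sum]
    refine Finset.sum_congr rfl fun i _ => ?_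
    rw [Matrix.diag_apply, Matrix.mul_diagonal, Matrix.mul_apply, Finset.sum_mul, Complex.re_sum]
    refine Finset.sum_congr rfl fun j _ => ?_
    rw [Matrix.conjTranspose_apply, Complex.re_mul_ofReal, mul_comm]
  have f2 : (Zᴴ * Matrix.diagonal (fun i => (b i : ℂ)) * Z).trace.re =
      ∑ i, ∑ j, b j * Complex.normSq (Z j i) := by
    rw [Matrix.trace, Complex.re_sum]
    refine Finset.sum_congr rfl fun i _ => ?_
    rw [Matrix.diag_apply, Matrix.mul_apply, Complex.re_sum]
    refine Finset.sum_congr rfl fun j _ => ?_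
    rw [Matrix.mul_diagonal, Matrix.conjTranspose_apply, Complex.normSq_apply]
    simp
    ring
  have f3 : (Z * Matrix.diagonal (fun i => (a i : ℂ)) * Zᴴ).trace.re =
      ∑ i, ∑ j, a i * Complex.normSq (Z j i) := by
    rw [Matrix.trace, Complex.re_sum, Finset.sum_comm]
    refine Finset.sum_congr rfl fun i _ => ?_
    rw [Matrix.diag_apply, Matrix.mul_apply, Complex.re_sum]
    refine Finset.sum_congr rfl fun j _ => ?_
    rw [Matrix.mul_diagonal, Matrix.conjTranspose_apply, Complex.normSq_apply]
    simp
    ring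
  rw [f1, f2, f3]
  simp only [Finset.mul_sum, ← Finset.sum_sub_distrib]
  refine Finset.sum_congr rfl fun i _ => Finset.sum_congr rfl fun j _ => ?_
  ring

theorem resolventForm_le (t : ℝ) (ht : 0 < t) (U W : Matrix.unitaryGroup n ℂ) (a b : n → ℝ)
    (ha : ∀ i, 0 ≤ a i) (hb : ∀ i, 0 ≤ b i) (X : Matrix n n ℂ) :
    resolventForm t (unitaryDiag U a) (unitaryDiag W b) X ≤
      ∑ i, ∑ j, sqOverlap U W i j * (a i ^ 2 / (b j + t * a i)) := by
  have hX : X = (W : Matrix n n ℂ) * ((W : Matrix n n ℂ)ᴴ * X * (U : Matrix n n ℂ)) *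
      (U : Matrix n n ℂ)ᴴ := by
    simp only [Matrix.mul_assoc, self_mul_conjTranspose_unitaryGroup, Matrix.mul_one]
    rw [← Matrix.mul_assoc, self_mul_conjTranspose_unitaryGroup, Matrix.one_mul]
  rw [hX, resolventForm_unitaryDiag]
  refine Finset.sum_le_sum fun i _ => Finset.sum_le_sum fun j _ => ?_
  generalize ((W : Matrix n n ℂ)ᴴ * X * (U : Matrix n n ℂ)) j i = z
  rw [sqOverlap]
  generalize ((W : Matrix n n ℂ)ᴴ * (U : Matrix n n ℂ)) j i = m
  rcases (ha i).eq_or_lt with h | h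
  · have := mul_nonneg (hb j) (Complex.normSq_nonneg z)
    simp [← h]
    exact this
  · have hc : 0 < b j + t * a i := add_pos_of_nonneg_of_pos (hb j) (mul_pos ht h)
    rw [mul_div_assoc', le_div_iff₀ hc]
    simp only [Complex.normSq_apply, Complex.mul_re, Complex.star_def, Complex.conj_re,
      Complex.conj_im]
    nlinarith [sq_nonneg ((b j + t * a i) * z.re - a i * m.re),
      sq_nonneg ((b j + t * a i) * z.im - a i * m.im)]

theorem exists_resolventForm_eq (t : ℝ) (ht : 0 < t) (U W : Matrix.unitaryGroup n ℂ)
    (a b : n → ℝ) (ha : ∀ i, 0 ≤ a i) (hb : ∀ i, 0 ≤ b i) :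
    ∃ X, resolventForm t (unitaryDiag U a) (unitaryDiag W b) X =
      ∑ i, ∑ j, sqOverlap U W i j * (a i ^ 2 / (b j + t * a i)) := by
  refine ⟨(W : Matrix n n ℂ) * (Matrix.of fun j i => ((a i / (b j + t * a i) : ℝ) : ℂ) *
    ((W : Matrix n n ℂ)ᴴ * (U : Matrix n n ℂ)) j i) * (U : Matrix n n ℂ)ᴴ, ?_⟩
  rw [resolventForm_unitaryDiag]
  refine Finset.sum_congr rfl fun i _ => Finset.sum_congr rfl fun j _ => ?_
  rw [sqOverlap, Matrix.of_apply]
  generalize ((W : Matrix n n ℂ)ᴴ * (U : Matrix n n ℂ)) j i = m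
  rcases (ha i).eq_or_lt with h | h
  · simp [← h]
  · have hc : 0 < b j + t * a i := add_pos_of_nonneg_of_pos (hb j) (mul_pos ht h)
    rw [Complex.normSq_mul, Complex.normSq_ofReal]
    simp only [Complex.normSq_apply, Complex.mul_re, Complex.mul_im, Complex.star_def,
      Complex.conj_re, Complex.conj_im, Complex.ofReal_re, Complex.ofReal_im]
    field_simp
    ring

/-- A Kadison–Schwarz inequality for the unital map `Y ↦ ∑ j, (V j)ᴴ * Y j * V j`. -/
theorem trace_schwarz {ι : Type*} [Fintype ι] (V Y : ι → Matrix n n ℂ)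
    (hV : ∑ j, (V j)ᴴ * V j = 1) (ρ : Matrix n n ℂ) (hρ : ρ.PosSemidef) :
    ((∑ j, (V j)ᴴ * Y j * V j) * ρ * (∑ j, (V j)ᴴ * Y j * V j)ᴴ).trace.re ≤
      ∑ j, (Y j * (V j * ρ * (V j)ᴴ) * (Y j)ᴴ).trace.re := by
  set X := ∑ j, (V j)ᴴ * Y j * V j with hX
  have h0 : 0 ≤ ∑ j, ((Y j * V j - V j * X) * ρ * (Y j * V j - V j * X)ᴴ).trace.re :=
    Finset.sum_nonneg fun j _ =>
      (Complex.le_def.mp (hρ.mul_mul_conjTranspose_same _).trace_nonneg).1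
  have hXH : Xᴴ = ∑ j, (V j)ᴴ * (Y j)ᴴ * V j := by
    rw [hX, Matrix.conjTranspose_sum]
    refine Finset.sum_congr rfl fun j _ => ?_
    simp [Matrix.conjTranspose_mul, Matrix.mul_assoc]
  have hj : ∀ j, ((Y j * V j - V j * X) * ρ * (Y j * V j - V j * X)ᴴ).trace =
      (Y j * (V j * ρ * (V j)ᴴ) * (Y j)ᴴ).trace - ((V j)ᴴ * Y j * V j * (ρ * Xᴴ)).trace -
        (X * ρ * ((V j)ᴴ * (Y j)ᴴ * V j)).trace + ((V j)ᴴ * V j * (X * ρ * Xᴴ)).trace := by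
    intro j
    have t1 : ((V j)ᴴ * Y j * V j * (ρ * Xᴴ)).trace = (Y j * V j * ρ * (V j * X)ᴴ).trace := by
      rw [Matrix.conjTranspose_mul, Matrix.mul_assoc, Matrix.mul_assoc, Matrix.trace_mul_comm]
      simp only [Matrix.mul_assoc]
    have t2 : (X * ρ * ((V j)ᴴ * (Y j)ᴴ * V j)).trace = (V j * X * ρ * (Y j * V j)ᴴ).trace := by
      rw [Matrix.conjTranspose_mul, ← Matrix.mul_assoc, Matrix.trace_mul_comm]
      simp only [Matrix.mul_assoc]
    have t3 : ((V j)ᴴ * V j * (X * ρ * Xᴴ)).trace = (V j * X * ρ * (V j * X)ᴴ).trace := by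
      rw [Matrix.conjTranspose_mul, Matrix.mul_assoc, Matrix.trace_mul_comm]
      simp only [Matrix.mul_assoc]
    rw [t1, t2, t3, Matrix.conjTranspose_sub]
    simp only [Matrix.sub_mul, Matrix.mul_sub, Matrix.trace_sub]
    simp only [Matrix.conjTranspose_mul, Matrix.mul_assoc]
    ring
  have hs : ∑ j, ((Y j * V j - V j * X) * ρ * (Y j * V j - V j * X)ᴴ).trace =
      ∑ j, (Y j * (V j * ρ * (V j)ᴴ) * (Y j)ᴴ).trace - (X * ρ * Xᴴ).trace := by
    simp only [hj, Finset.sum_add_distrib, Finset.sum_sub_distrib]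
    rw [← Matrix.trace_sum, ← Matrix.trace_sum, ← Matrix.trace_sum, ← Matrix.trace_sum,
      ← Finset.sum_mul, ← Finset.mul_sum, ← Finset.sum_mul, hV, ← hX, ← hXH, Matrix.one_mul,
      Matrix.mul_assoc]
    ring
  rw [← Complex.re_sum, hs, Complex.sub_re, Complex.re_sum] at h0
  linarith

end Variational

section Instrument

variable {d : ℕ} {Ω K : Type*} [Fintype K]

theorem instrOp_sub (V : Ω → K → Matrix (Fin d) (Fin d) ℂ) (ω : Ω)
    (ρ σ : Matrix (Fin d) (Fin d) ℂ) :
    instrOp V ω (ρ - σ) = instrOp V ω ρ - instrOp V ω σ := by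
  simp [instrOp, Matrix.mul_sub, Matrix.sub_mul, Finset.sum_sub_distrib]

theorem instrOp_smul (V : Ω → K → Matrix (Fin d) (Fin d) ℂ) (ω : Ω) (c : ℝ)
    (ρ : Matrix (Fin d) (Fin d) ℂ) : instrOp V ω (c • ρ) = c • instrOp V ω ρ := by
  simp [instrOp, Finset.smul_sum]

theorem instrOp_sum {A : Type*} [Fintype A] (V : Ω → K → Matrix (Fin d) (Fin d) ℂ) (ω : Ω)
    (ρ : A → Matrix (Fin d) (Fin d) ℂ) :
    instrOp V ω (∑ α, ρ α) = ∑ α, instrOp V ω (ρ α) := by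
  simp only [instrOp, Finset.mul_sum, Finset.sum_mul]
  exact Finset.sum_comm

theorem instrOp_posSemidef (V : Ω → K → Matrix (Fin d) (Fin d) ℂ) (ω : Ω)
    {ρ : Matrix (Fin d) (Fin d) ℂ} (hρ : ρ.PosSemidef) : (instrOp V ω ρ).PosSemidef :=
  Matrix.posSemidef_sum _ fun k _ => hρ.mul_mul_conjTranspose_same (V ω k)

theorem trace_instrOp (V : Ω → K → Matrix (Fin d) (Fin d) ℂ) (ω : Ω)
    (ρ : Matrix (Fin d) (Fin d) ℂ) :
    (instrOp V ω ρ).trace = (instrPOV V ω * ρ).trace := by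
  simp only [instrOp, instrPOV, Finset.sum_mul, Matrix.trace_sum]
  refine Finset.sum_congr rfl fun k _ => ?_
  rw [Matrix.trace_mul_comm, ← Matrix.mul_assoc]

theorem outcomeProb_nonneg (V : Ω → K → Matrix (Fin d) (Fin d) ℂ) (ω : Ω)
    {ρ : Matrix (Fin d) (Fin d) ℂ} (hρ : ρ.PosSemidef) : 0 ≤ outcomeProb V ρ ω := by
  rw [outcomeProb, ← trace_instrOp]
  exact (Complex.le_def.mp (instrOp_posSemidef V ω hρ).trace_nonneg).1

theorem outcomeProb_smul_postState (V : Ω → K → Matrix (Fin d) (Fin d) ℂ) (ω : Ω)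
    {ρ : Matrix (Fin d) (Fin d) ℂ} (hρ : ρ.PosSemidef) :
    outcomeProb V ρ ω • postState V ρ ω = instrOp V ω ρ := by
  by_cases h : outcomeProb V ρ ω = 0
  · have hO := instrOp_posSemidef V ω hρ
    have h0 : (instrOp V ω ρ).trace = 0 := by
      refine Complex.ext ?_ (Complex.le_def.mp hO.trace_nonneg).2.symm
      rw [trace_instrOp]
      exact h
    rw [hO.trace_eq_zero_iff.mp h0, h, zero_smul]
  · rw [postState, smul_smul, mul_inv_cancel₀ h, one_smul]

theorem postState_posSemidef (V : Ω → K → Matrix (Fin d) (Fin d) ℂ) (ω : Ω)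
    {ρ : Matrix (Fin d) (Fin d) ℂ} (hρ : ρ.PosSemidef) : (postState V ρ ω).PosSemidef :=
  (instrOp_posSemidef V ω hρ).smul (inv_nonneg.mpr (outcomeProb_nonneg V ω hρ))

theorem trace_postState (V : Ω → K → Matrix (Fin d) (Fin d) ℂ) (ω : Ω)
    {ρ : Matrix (Fin d) (Fin d) ℂ} (h : outcomeProb V ρ ω ≠ 0) :
    (postState V ρ ω).trace.re = 1 := by
  rw [postState, Matrix.trace_smul, Complex.smul_re, trace_instrOp]
  exact inv_mul_cancel₀ h

variable [Fintype Ω]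

theorem sum_outcomeProb (V : Ω → K → Matrix (Fin d) (Fin d) ℂ) (hV : ∑ ω, instrPOV V ω = 1)
    (ρ : Matrix (Fin d) (Fin d) ℂ) : ∑ ω, outcomeProb V ρ ω = ρ.trace.re := by
  simp only [outcomeProb]
  rw [← Complex.re_sum, ← Matrix.trace_sum, ← Finset.sum_mul, hV, Matrix.one_mul]

theorem sum_resolventForm_instrOp_le (V : Ω → K → Matrix (Fin d) (Fin d) ℂ)
    (hV : ∑ ω, instrPOV V ω = 1) (t : ℝ) (ht : 0 < t) {ρ σ : Matrix (Fin d) (Fin d) ℂ}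
    (hρ : ρ.PosSemidef) (hσ : σ.PosSemidef) (Y : Ω → Matrix (Fin d) (Fin d) ℂ) :
    ∑ ω, resolventForm t (instrOp V ω ρ) (instrOp V ω σ) (Y ω) ≤
      resolventForm t ρ σ (∑ ω, ∑ k, (V ω k)ᴴ * Y ω * V ω k) := by
  have hV' : ∑ x : Ω × K, (V x.1 x.2)ᴴ * V x.1 x.2 = 1 := by
    rw [Fintype.sum_prod_type]
    exact hV
  have h1 := trace_schwarz (fun x : Ω × K => V x.1 x.2) (fun x => Y x.1) hV' ρ hρ
  have h2 := trace_schwarz (fun x : Ω × K => V x.1 x.2) (fun x => (Y x.1)ᴴ) hV' σ hσ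
  simp only [Fintype.sum_prod_type] at h1 h2
  have hXH : ∑ ω, ∑ k, (V ω k)ᴴ * (Y ω)ᴴ * V ω k = (∑ ω, ∑ k, (V ω k)ᴴ * Y ω * V ω k)ᴴ := by
    simp [Matrix.conjTranspose_sum, Matrix.conjTranspose_mul, Matrix.mul_assoc]
  rw [hXH] at h2
  simp only [Matrix.conjTranspose_conjTranspose] at h2
  set X := ∑ ω, ∑ k, (V ω k)ᴴ * Y ω * V ω k with hX
  have e1 : ∑ ω, ((Y ω)ᴴ * instrOp V ω ρ).trace.re = (Xᴴ * ρ).trace.re := by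
    rw [← hXH]
    simp only [instrOp, Finset.mul_sum, Finset.sum_mul, Matrix.trace_sum, Complex.re_sum]
    refine Finset.sum_congr rfl fun ω _ => Finset.sum_congr rfl fun k _ => ?_
    rw [← Matrix.mul_assoc, Matrix.trace_mul_comm]
    simp only [Matrix.mul_assoc]
  have e2 : ∑ ω, ((Y ω)ᴴ * instrOp V ω σ * Y ω).trace.re =
      ∑ ω, ∑ k, ((Y ω)ᴴ * (V ω k * σ * (V ω k)ᴴ) * Y ω).trace.re := by
    simp only [instrOp, Finset.mul_sum, Finset.sum_mul, Matrix.trace_sum, Complex.re_sum]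
  have e3 : ∑ ω, (Y ω * instrOp V ω ρ * (Y ω)ᴴ).trace.re =
      ∑ ω, ∑ k, (Y ω * (V ω k * ρ * (V ω k)ᴴ) * (Y ω)ᴴ).trace.re := by
    simp only [instrOp, Finset.mul_sum, Finset.sum_mul, Matrix.trace_sum, Complex.re_sum]
  simp only [resolventForm, Finset.sum_sub_distrib, ← Finset.mul_sum]
  rw [e1, e2, e3]
  have h3 := mul_le_mul_of_nonneg_left h1 ht.le
  linarith

end Instrument

section RelativeEntropy

variable {d : ℕ}

/-- The relative entropy in terms of eigenvalues and overlaps of eigenvectors. -/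
noncomputable def spectralRelEntropy {n : Type*} [Fintype n] [DecidableEq n] (U W : Matrix.unitaryGroup n ℂ)
    (a b : n → ℝ) : ℝ :=
  ∑ i, ∑ j, sqOverlap U W i j * (a i * (Real.log (a i) - Real.log (b j)))

theorem sum_spectralRelEntropy_instrOp_le {Ω K : Type*} [Fintype Ω] [Fintype K]
    (V : Ω → K → Matrix (Fin d) (Fin d) ℂ) (hV : ∑ ω, instrPOV V ω = 1)
    {ρ σ : Matrix (Fin d) (Fin d) ℂ} (hρ : ρ.PosSemidef) (hσ : σ.PosSemidef)
    {c : ℝ} (hc : (c • σ - ρ).PosSemidef)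
    (U W : Matrix.unitaryGroup (Fin d) ℂ) (a b : Fin d → ℝ)
    (ha : ∀ i, 0 ≤ a i) (hb : ∀ i, 0 ≤ b i) (hρU : ρ = unitaryDiag U a) (hσW : σ = unitaryDiag W b)
    (U' W' : Ω → Matrix.unitaryGroup (Fin d) ℂ) (a' b' : Ω → Fin d → ℝ)
    (ha' : ∀ ω i, 0 ≤ a' ω i) (hb' : ∀ ω i, 0 ≤ b' ω i)
    (hρU' : ∀ ω, instrOp V ω ρ = unitaryDiag (U' ω) (a' ω))
    (hσW' : ∀ ω, instrOp V ω σ = unitaryDiag (W' ω) (b' ω)) :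
    ∑ ω, spectralRelEntropy (U' ω) (W' ω) (a' ω) (b' ω) ≤ spectralRelEntropy U W a b := by
  have key := sum_mul_log_sub_log_nonneg
    (ι := (Fin d × Fin d) ⊕ (Ω × Fin d × Fin d))
    (Sum.elim (fun x => sqOverlap U W x.1 x.2)
      (fun x => -sqOverlap (U' x.1) (W' x.1) x.2.1 x.2.2))
    (Sum.elim (fun x => a x.1) (fun x => a' x.1 x.2.1))
    (Sum.elim (fun x => b x.2) (fun x => b' x.1 x.2.2))
    (by rintro (x | x); exacts [ha _, ha' _ _])
    (by rintro (x | x); exacts [hb _, hb' _ _])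
    (by
      rintro (⟨i, j⟩ | ⟨ω, i, j⟩) h1 h2
      · rw [hρU, hσW] at hc
        exact ne_zero_of_posSemidef_smul_sub U W a b ha c hc i j h1 h2
      · have h := instrOp_posSemidef V ω hc
        rw [instrOp_sub, instrOp_smul, hρU', hσW'] at h
        exact ne_zero_of_posSemidef_smul_sub (U' ω) (W' ω) (a' ω) (b' ω) (ha' ω) c h i j
          (neg_ne_zero.mp h1) h2)
    (by
      simp only [Fintype.sum_sum_type, Fintype.sum_prod_type, Sum.elim_inl, Sum.elim_inr, neg_mul,
        Finset.sum_neg_distrib, sum_sqOverlap_mul]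
      have h1 : ∑ i, a i = ρ.trace.re := by
        rw [hρU, trace_unitaryDiag, Complex.re_sum]
        simp
      have h2 : ∀ ω, ∑ i, a' ω i = outcomeProb V ρ ω := fun ω => by
        rw [outcomeProb, ← trace_instrOp, hρU', trace_unitaryDiag, Complex.re_sum]
        simp
      simp only [h1, h2, sum_outcomeProb V hV, add_neg_cancel])
    (by
      intro t ht
      simp only [Fintype.sum_sum_type, Fintype.sum_prod_type, Sum.elim_inl, Sum.elim_inr, neg_mul,
        Finset.sum_neg_distrib]
      choose Y hY using fun ω =>
        exists_resolventForm_eq t ht (U' ω) (W' ω) (a' ω) (b' ω) (ha' ω) (hb' ω)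
      have h1 := sum_resolventForm_instrOp_le V hV t ht hρ hσ Y
      simp only [hρU', hσW', hY] at h1
      rw [hρU, hσW] at h1
      have h2 := h1.trans (resolventForm_le t ht U W a b ha hb _)
      linarith)
  simp only [Fintype.sum_sum_type, Fintype.sum_prod_type, Sum.elim_inl, Sum.elim_inr, neg_mul,
    Finset.sum_neg_distrib] at key
  simp only [spectralRelEntropy]
  linarith

theorem eq_unitaryDiag_of_isHermitian {A : Matrix (Fin d) (Fin d) ℂ} (hA : A.IsHermitian) :
    A = unitaryDiag hA.eigenvectorUnitary hA.eigenvalues :=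
  hA.spectral_theorem

theorem matLog_of_isHermitian {A : Matrix (Fin d) (Fin d) ℂ} (hA : A.IsHermitian) :
    matLog A = unitaryDiag hA.eigenvectorUnitary (fun i => Real.log (hA.eigenvalues i)) := by
  rw [matLog, dif_pos hA]
  rfl

theorem qRelEntropy_eq_spectralRelEntropy {ρ σ : Matrix (Fin d) (Fin d) ℂ}
    (hρ : ρ.IsHermitian) (hσ : σ.IsHermitian) :
    qRelEntropy ρ σ = spectralRelEntropy hρ.eigenvectorUnitary hσ.eigenvectorUnitary
      hρ.eigenvalues hσ.eigenvalues := by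
  rw [qRelEntropy, matLog_of_isHermitian hρ, matLog_of_isHermitian hσ]
  nth_rw 1 [eq_unitaryDiag_of_isHermitian hρ]
  rw [Matrix.mul_sub, Matrix.trace_sub, Complex.sub_re, unitaryDiag_mul, trace_unitaryDiag_mul,
    trace_unitaryDiag, Complex.re_sum, spectralRelEntropy]
  simp only [Complex.ofReal_re]
  rw [← sum_sqOverlap_mul hρ.eigenvectorUnitary hσ.eigenvectorUnitary]
  simp only [← Finset.sum_sub_distrib]
  refine Finset.sum_congr rfl fun i _ => Finset.sum_congr rfl fun j _ => ?_
  ring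

theorem spectralRelEntropy_mul {n : Type*} [Fintype n] [DecidableEq n]
    (U W : Matrix.unitaryGroup n ℂ) (a b : n → ℝ) {p q : ℝ} (hp : p ≠ 0) (hq : q ≠ 0)
    (hab : ∀ i j, sqOverlap U W i j ≠ 0 → a i ≠ 0 → b j ≠ 0) (ha : ∑ i, a i = 1) :
    spectralRelEntropy U W (fun i => p * a i) (fun j => q * b j) =
      p * (Real.log (p / q) + spectralRelEntropy U W a b) := by
  have h : ∀ i j, sqOverlap U W i j *
      (p * a i * (Real.log (p * a i) - Real.log (q * b j))) =
      p * (sqOverlap U W i j * a i * Real.log (p / q) +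
        sqOverlap U W i j * (a i * (Real.log (a i) - Real.log (b j)))) := by
    intro i j
    by_cases h1 : sqOverlap U W i j = 0
    · simp [h1]
    by_cases h2 : a i = 0
    · simp [h2]
    rw [Real.log_mul hp h2, Real.log_mul hq (hab i j h1 h2), Real.log_div hp hq]
    ring
  have h' : ∑ i, ∑ j, sqOverlap U W i j * a i * Real.log (p / q) = Real.log (p / q) := by
    simp only [← Finset.sum_mul _ _ (Real.log (p / q)), sum_sqOverlap_mul, ha, one_mul]
  simp only [spectralRelEntropy, h, ← Finset.mul_sum, Finset.sum_add_distrib, h']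

/-- Monotonicity of the relative entropy under the channel `ρ ↦ ⨁ ω, O(ω)[ρ]`. -/
theorem sum_outcomeProb_mul_le_qRelEntropy {Ω K : Type*} [Fintype Ω] [Fintype K]
    (V : Ω → K → Matrix (Fin d) (Fin d) ℂ) (hV : ∑ ω, instrPOV V ω = 1)
    {ρ σ : Matrix (Fin d) (Fin d) ℂ} (hρ : ρ.PosSemidef) (hσ : σ.PosSemidef)
    {c : ℝ} (hc : (c • σ - ρ).PosSemidef) :
    ∑ ω, outcomeProb V ρ ω * (Real.log (outcomeProb V ρ ω / outcomeProb V σ ω) +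
      qRelEntropy (postState V ρ ω) (postState V σ ω)) ≤ qRelEntropy ρ σ := by
  have hP : ∀ ω, (postState V ρ ω).PosSemidef := fun ω => postState_posSemidef V ω hρ
  have hQ : ∀ ω, (postState V σ ω).PosSemidef := fun ω => postState_posSemidef V ω hσ
  have hp := fun ω => outcomeProb_nonneg V ω hρ
  have hq := fun ω => outcomeProb_nonneg V ω hσ
  have eP : ∀ ω, instrOp V ω ρ = unitaryDiag (hP ω).isHermitian.eigenvectorUnitary
      (fun i => outcomeProb V ρ ω * (hP ω).isHermitian.eigenvalues i) := fun ω => by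
    rw [← unitaryDiag_smul, ← eq_unitaryDiag_of_isHermitian, outcomeProb_smul_postState V ω hρ]
  have eQ : ∀ ω, instrOp V ω σ = unitaryDiag (hQ ω).isHermitian.eigenvectorUnitary
      (fun i => outcomeProb V σ ω * (hQ ω).isHermitian.eigenvalues i) := fun ω => by
    rw [← unitaryDiag_smul, ← eq_unitaryDiag_of_isHermitian, outcomeProb_smul_postState V ω hσ]
  have key := sum_spectralRelEntropy_instrOp_le V hV hρ hσ hc
    hρ.isHermitian.eigenvectorUnitary hσ.isHermitian.eigenvectorUnitary
    hρ.isHermitian.eigenvalues hσ.isHermitian.eigenvalues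
    hρ.eigenvalues_nonneg hσ.eigenvalues_nonneg
    (eq_unitaryDiag_of_isHermitian _) (eq_unitaryDiag_of_isHermitian _)
    _ _ _ _
    (fun ω i => mul_nonneg (hp ω) ((hP ω).eigenvalues_nonneg i))
    (fun ω i => mul_nonneg (hq ω) ((hQ ω).eigenvalues_nonneg i)) eP eQ
  rw [qRelEntropy_eq_spectralRelEntropy hρ.isHermitian hσ.isHermitian]
  refine le_trans (le_of_eq (Finset.sum_congr rfl fun ω _ => ?_)) key
  by_cases h0 : outcomeProb V ρ ω = 0
  · simp [h0, spectralRelEntropy]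
  have hO := instrOp_posSemidef V ω hc
  rw [instrOp_sub, instrOp_smul] at hO
  have hq0 : outcomeProb V σ ω ≠ 0 := by
    intro h
    have h1 := (Complex.le_def.mp hO.trace_nonneg).1
    rw [Matrix.trace_sub, Matrix.trace_smul, Complex.sub_re, Complex.smul_re, trace_instrOp,
      trace_instrOp] at h1
    change 0 ≤ c • outcomeProb V σ ω - outcomeProb V ρ ω at h1
    rw [h, smul_zero] at h1
    exact h0 (le_antisymm (by linarith) (hp ω))
  rw [qRelEntropy_eq_spectralRelEntropy (hP ω).isHermitian (hQ ω).isHermitian,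
    spectralRelEntropy_mul _ _ _ _ h0 hq0]
  · intro i j h1 h2
    rw [eP, eQ] at hO
    exact right_ne_zero_of_mul (ne_zero_of_posSemidef_smul_sub _ _ _ _
      (fun i => mul_nonneg (hp ω) ((hP ω).eigenvalues_nonneg i)) c hO i j h1 (mul_ne_zero h0 h2))
  · rw [← trace_postState V ω h0, (hP ω).isHermitian.trace_eq_sum_eigenvalues]
    simp

end RelativeEntropy

section ChiQuantity

variable {d : ℕ} {X : Type*} [Fintype X]

theorem sum_filter_pos_mul (p f : X → ℝ) (hp : ∀ x, 0 ≤ p x) :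
    ∑ x ∈ Finset.univ.filter (fun x => 0 < p x), p x * f x = ∑ x, p x * f x := by
  refine Finset.sum_filter_of_ne fun x _ h => (hp x).lt_of_ne' ?_
  exact left_ne_zero_of_mul h

theorem chiQuantity_eq_sum (p : X → ℝ) (hp : ∀ x, 0 ≤ p x)
    (σ : X → Matrix (Fin d) (Fin d) ℂ) :
    chiQuantity p σ = ∑ x, p x * qRelEntropy (σ x) (∑ y, p y • σ y) :=
  sum_filter_pos_mul p _ hp

theorem mul_qRelEntropy_eq_add (p : ℝ) (ρ σ τ : Matrix (Fin d) (Fin d) ℂ) :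
    p * qRelEntropy ρ τ = p * qRelEntropy ρ σ + ((p • ρ) * (matLog σ - matLog τ)).trace.re := by
  have : qRelEntropy ρ τ = qRelEntropy ρ σ + (ρ * (matLog σ - matLog τ)).trace.re := by
    simp only [qRelEntropy, Matrix.mul_sub, Matrix.trace_sub, Complex.sub_re]
    ring
  rw [this, Matrix.smul_mul, Matrix.trace_smul, Complex.smul_re, mul_add, smul_eq_mul]

/-- Donald-type identity for an ensemble that refines another one. -/
theorem chiQuantity_refinement {Ω : Type*} [Fintype Ω] (r : X × Ω → ℝ) (hr : ∀ x, 0 ≤ r x)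
    (τ : X × Ω → Matrix (Fin d) (Fin d) ℂ) (q : Ω → ℝ) (hq : ∀ ω, 0 ≤ q ω)
    (σ : Ω → Matrix (Fin d) (Fin d) ℂ) (h : ∀ ω, ∑ x, r (x, ω) • τ (x, ω) = q ω • σ ω) :
    chiQuantity r τ =
      ∑ x, ∑ ω, r (x, ω) * qRelEntropy (τ (x, ω)) (σ ω) + chiQuantity q σ := by
  have hav : ∑ y, r y • τ y = ∑ ω, q ω • σ ω := by
    rw [Fintype.sum_prod_type_right]
    exact Finset.sum_congr rfl fun ω _ => h ω
  rw [chiQuantity_eq_sum r hr, chiQuantity_eq_sum q hq, hav, Fintype.sum_prod_type]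
  set m := ∑ ω, q ω • σ ω
  simp only [fun x ω => mul_qRelEntropy_eq_add (r (x, ω)) (τ (x, ω)) (σ ω) m,
    Finset.sum_add_distrib]
  congr 1
  rw [Finset.sum_comm]
  refine Finset.sum_congr rfl fun ω _ => ?_
  rw [← Complex.re_sum, ← Matrix.trace_sum, ← Finset.sum_mul, h, Matrix.smul_mul,
    Matrix.trace_smul, Complex.smul_re, smul_eq_mul, qRelEntropy]

end ChiQuantity

/-- symmetric form of the SWW bound. -/
theorem sww_bound_symmetric_form {d : ℕ} (hd : 1 ≤ d)
    {A Ω K : Type*} [Fintype A] [Fintype Ω] [Fintype K]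
    (p : A → ℝ) (hp : ∀ α, 0 ≤ p α) (hp1 : ∑ α, p α = 1)
    (ρ : A → Matrix (Fin d) (Fin d) ℂ)
    (hρ : ∀ α, (ρ α).PosSemidef) (hρtr : ∀ α, (ρ α).trace = 1)
    (V : Ω → K → Matrix (Fin d) (Fin d) ℂ)
    (hV : ∑ ω, instrPOV V ω = 1) :
    let η := ∑ α, p α • ρ α
    let pf := fun ω => outcomeProb V η ω
    let pfi := fun ω α => outcomeProb V (ρ α) ω
    let ρf := fun α ω => (pfi ω α)⁻¹ • instrOp V ω (ρ α)
    let ρfbar := fun ω => (pf ω)⁻¹ • instrOp V ω η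
    mutualInfo p ρ (instrPOV V) ≤
      chiQuantity p ρ + chiQuantity pf ρfbar -
        chiQuantity (fun x : A × Ω => p x.1 * pfi x.2 x.1) (fun x => ρf x.1 x.2) := by
  classical
  intro η pf pfi ρf ρfbar
  have hpρ : ∀ α, (p α • ρ α).PosSemidef := fun α => (hρ α).smul (hp α)
  have hη : η.PosSemidef := Matrix.posSemidef_sum _ fun α _ => hpρ α
  have hpf : ∀ ω, 0 ≤ pf ω := fun ω => outcomeProb_nonneg V ω hη
  have hpfi : ∀ ω α, 0 ≤ pfi ω α := fun ω α => outcomeProb_nonneg V ω (hρ α)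
  have hpif : ∀ x : A × Ω, 0 ≤ p x.1 * pfi x.2 x.1 := fun x => mul_nonneg (hp _) (hpfi _ _)
  have hchi := chiQuantity_refinement (fun x : A × Ω => p x.1 * pfi x.2 x.1) hpif
    (fun x => ρf x.1 x.2) pf hpf ρfbar (fun ω => by
      have h1 : pf ω • ρfbar ω = instrOp V ω η := outcomeProb_smul_postState V ω hη
      have h2 : ∀ α, pfi ω α • ρf α ω = instrOp V ω (ρ α) := fun α =>
        outcomeProb_smul_postState V ω (hρ α)
      rw [h1, instrOp_sum]
      refine Finset.sum_congr rfl fun α _ => ?_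
      rw [mul_smul, h2, instrOp_smul])
  have hmut : mutualInfo p ρ (instrPOV V) =
      ∑ α, ∑ ω, p α * pfi ω α * Real.log (pfi ω α / pf ω) := by
    rw [mutualInfo, sum_filter_pos_mul
      (fun x : A × Ω => p x.1 * povProb (instrPOV V) (ρ x.1) x.2) _ hpif, Fintype.sum_prod_type]
    refine Finset.sum_congr rfl fun α _ => Finset.sum_congr rfl fun ω _ => ?_
    change p α * pfi ω α * Real.log (p α * pfi ω α / (p α * pf ω)) = _
    by_cases h : p α = 0
    · simp [h]
    · rw [mul_div_mul_left _ _ h]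
  rw [hchi, hmut, chiQuantity_eq_sum p hp]
  have hα : ∀ α, ∑ ω, p α * pfi ω α * Real.log (pfi ω α / pf ω) +
      ∑ ω, p α * pfi ω α * qRelEntropy (ρf α ω) (ρfbar ω) ≤ p α * qRelEntropy (ρ α) η := by
    intro α
    rcases (hp α).eq_or_lt with h | h
    · simp [← h]
    have hc : ((p α)⁻¹ • η - ρ α).PosSemidef := by
      have h1 : (p α)⁻¹ • η - ρ α = (p α)⁻¹ • (η - p α • ρ α) := by
        rw [smul_sub, smul_smul, inv_mul_cancel₀ h.ne', one_smul]
      have h2 : η - p α • ρ α = ∑ β ∈ Finset.univ.erase α, p β • ρ β := by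
        rw [sub_eq_iff_eq_add, Finset.sum_erase_add _ _ (Finset.mem_univ α)]
      rw [h1, h2]
      exact (Matrix.posSemidef_sum _ fun β _ => hpρ β).smul (inv_nonneg.mpr h.le)
    have key := sum_outcomeProb_mul_le_qRelEntropy V hV (hρ α) hη hc
    refine le_trans (le_of_eq ?_) (mul_le_mul_of_nonneg_left key h.le)
    rw [Finset.mul_sum, ← Finset.sum_add_distrib]
    refine Finset.sum_congr rfl fun ω _ => ?_
    change _ = p α * (pfi ω α * (Real.log (pfi ω α / pf ω) + qRelEntropy (ρf α ω) (ρfbar ω)))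
    ring
  have hsum := Finset.sum_le_sum fun α (_ : α ∈ Finset.univ) => hα α
  rw [Finset.sum_add_distrib] at hsum
  linarith
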